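/- Let T ∈ (0,∞]. Suppose the conditional distribution of τ is differentiable at every t ∈ [0,T) with respect to A (with some density p_t). Then for every t ∈ [0,T), the restriction of Q̌ to the σ-algebra Ǧ⁰_t = ⋂_{s>t}(F̌_s ∨ σ(τ̂∤s)) is absolutely continuous with respect to the restriction of the Cox measure Q̌⁰ to Ǧ⁰_t. -/

import Mathlib

open MeasureTheory
open scoped ENNReal

/-- The operation `a ∤ b`: equals `a` if `a ≤ b` and `∞` otherwise. -/
noncomputable def nmid (a b : ℝ≥0∞) : ℝ≥0∞ := if a ≤ b then a else ∞

lemma generateFrom_image2_prod_range_Iic {Ω : Type*} [MeasurableSpace Ω] :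
    MeasurableSpace.generateFrom
      (Set.image2 (· ×ˢ ·) {B : Set Ω | MeasurableSet B} (Set.range (Set.Iic : ℝ≥0∞ → Set ℝ≥0∞)))
      = (Prod.instMeasurableSpace : MeasurableSpace (Ω × ℝ≥0∞)) := by
  refine generateFrom_eq_prod MeasurableSpace.generateFrom_measurableSet ?_
    isCountablySpanning_measurableSet
    ⟨fun _ => Set.Iic ∞, fun _ => ⟨∞, rfl⟩, by simp [Set.iUnion_const]⟩
  rw [← borel_eq_generateFrom_Iic]
  exact BorelSpace.measurable_eq.symm

lemma isPiSystem_image2_prod_range_Iic {Ω : Type*} [MeasurableSpace Ω] :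
    IsPiSystem
      (Set.image2 (· ×ˢ ·) {B : Set Ω | MeasurableSet B}
        (Set.range (Set.Iic : ℝ≥0∞ → Set ℝ≥0∞))) := by
  refine MeasurableSpace.isPiSystem_measurableSet.prod ?_
  rintro _ ⟨a, rfl⟩ _ ⟨b, rfl⟩ -
  exact ⟨a ⊓ b, Set.Iic_inter_Iic.symm⟩

/-- Partial integrals over `[0, r]` against a random measure whose distribution function is
measurable up to `r` are measurable. -/
lemma measurable_setLIntegral_Iic {Ω : Type*} [MeasurableSpace Ω] {ν : Ω → Measure ℝ≥0∞}
    [∀ ω, IsProbabilityMeasure (ν ω)] {r : ℝ≥0∞} (hν : ∀ u ≤ r, Measurable fun ω => ν ω (Set.Iic u))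
    {f : Ω × ℝ≥0∞ → ℝ≥0∞} (hf : Measurable f) :
    Measurable fun ω => ∫⁻ v in Set.Iic r, f (ω, v) ∂(ν ω) := by
  have hκ : Measurable fun ω => (ν ω).restrict (Set.Iic r) := by
    refine Measurable.measure_of_isPiSystem
      (S := Set.range (Set.Iic : ℝ≥0∞ → Set ℝ≥0∞)) ?_ ?_ ?_ ?_
    · rw [← borel_eq_generateFrom_Iic]
      exact BorelSpace.measurable_eq
    · rintro _ ⟨a, rfl⟩ _ ⟨b, rfl⟩ -
      exact ⟨a ⊓ b, Set.Iic_inter_Iic.symm⟩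
    · rintro _ ⟨a, rfl⟩
      simp_rw [Measure.restrict_apply measurableSet_Iic, Set.Iic_inter_Iic]
      exact hν _ inf_le_right
    · simpa using hν r le_rfl
  let κ : ProbabilityTheory.Kernel Ω ℝ≥0∞ := ⟨_, hκ⟩
  have : ProbabilityTheory.IsFiniteKernel κ :=
    ⟨1, ENNReal.one_lt_top, fun ω => (Measure.restrict_apply_le _ _).trans prob_le_one⟩
  exact hf.lintegral_kernel_prod_right' (κ := κ)

lemma setLIntegral_ofReal_toReal_eq_measure_inter {Ω : Type*} {m m0 : MeasurableSpace Ω}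
    (hm : m ≤ m0) {Q : Measure Ω} [IsFiniteMeasure Q] {E B : Set Ω} (hE : MeasurableSet[m0] E)
    (hB : MeasurableSet[m] B) {g : Ω → ℝ≥0∞}
    (hg : (fun ω => (g ω).toReal) =ᵐ[Q] Q[E.indicator (fun _ => (1 : ℝ)) | m]) :
    ∫⁻ ω in B, ENNReal.ofReal (g ω).toReal ∂Q = Q (B ∩ E) := by
  have hint : Integrable (fun ω => (g ω).toReal) Q := integrable_condExp.congr hg.symm
  rw [← ofReal_integral_eq_lintegral_ofReal hint.restrict
      (Filter.Eventually.of_forall fun _ => ENNReal.toReal_nonneg),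
    integral_congr_ae (ae_restrict_of_ae hg),
    setIntegral_condExp hm ((integrable_const _).indicator hE) hB,
    setIntegral_indicator hE]
  simp

lemma measurable_nmid_left (r : ℝ≥0∞) : Measurable fun a => nmid a r :=
  Measurable.ite measurableSet_Iic measurable_id measurable_const

lemma measurable_prodMk_nmid {Ω : Type*} [MeasurableSpace Ω] (r : ℝ≥0∞) :
    Measurable fun p : Ω × ℝ≥0∞ => (p.1, nmid p.2 r) :=
  measurable_fst.prodMk ((measurable_nmid_left r).comp measurable_snd)

lemma exists_preimage_of_measurableSet_sup_comap_nmid {Ω : Type*} [MeasurableSpace Ω] {r : ℝ≥0∞}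
    {s : Set (Ω × ℝ≥0∞)}
    (hs : MeasurableSet[(‹MeasurableSpace Ω›).comap Prod.fst ⊔
      MeasurableSpace.comap (fun p : Ω × ℝ≥0∞ => nmid p.2 r)
        (inferInstance : MeasurableSpace ℝ≥0∞)] s) :
    ∃ S : Set (Ω × ℝ≥0∞), MeasurableSet S ∧ s = (fun p => (p.1, nmid p.2 r)) ⁻¹' S := by
  have h : (‹MeasurableSpace Ω›).comap Prod.fst ⊔
      MeasurableSpace.comap (fun p : Ω × ℝ≥0∞ => nmid p.2 r)
        (inferInstance : MeasurableSpace ℝ≥0∞) =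
      MeasurableSpace.comap (fun p : Ω × ℝ≥0∞ => (p.1, nmid p.2 r)) inferInstance := by
    rw [Prod.instMeasurableSpace, MeasurableSpace.prod, MeasurableSpace.comap_sup,
      MeasurableSpace.comap_comp, MeasurableSpace.comap_comp]
    rfl
  rw [h] at hs
  obtain ⟨S, hS, rfl⟩ := hs
  exact ⟨S, hS, rfl⟩

/-- Let `T ∈ (0,∞]` and suppose the conditional distribution of `τ` is
differentiable at every `t ∈ [0,T)` with respect to `A` (with some density `p_t`):
for each `t < T` there is a nonnegative `F_t ⊗ B([0,∞])`-measurable `p_t` with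
`ω ↦ ∫_[0,u] p_t (ω,v) d(ν ω) v` a version of `Q[τ ≤ u | F t]` for each `u ≤ t`, where
`ν ω` is the probability measure on `[0,∞]` with `ν ω [0,u] = A u ω`.  Then for every
`t ∈ [0,T)`, `Q̌ = φ_* Q` (with `φ ω = (ω, τ ω)`) is absolutely continuous with respect
to the Cox measure `Q̌⁰` on the σ-algebra `Ǧ⁰_t = ⋂_{s > t} (F̌ s ∨ σ(τ̂ ∤ s))`: every
`Ǧ⁰_t`-measurable set which is `Q̌⁰`-null is `Q̌`-null. -/
theorem differentiable_iM_absolutelyContinuous_cox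
    {Ω : Type*} [𝒜 : MeasurableSpace Ω]
    (Q : Measure Ω) [IsProbabilityMeasure Q]
    (F : ℝ≥0∞ → MeasurableSpace Ω) (hF_le : ∀ t, F t ≤ 𝒜) (hF_mono : Monotone F)
    (τ : Ω → ℝ≥0∞) (hτ : Measurable τ)
    (A : ℝ≥0∞ → Ω → ℝ)
    (hA_adapted : ∀ t, @Measurable Ω ℝ (F t) _ (A t))
    (hA_mono : ∀ ω, Monotone fun t => A t ω)
    (hA_rc : ∀ ω, ∀ t : ℝ≥0∞, ContinuousWithinAt (fun s => A s ω) (Set.Ici t) t)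
    (hA_mem : ∀ (t : ℝ≥0∞) (ω), t ≠ ∞ → A t ω ∈ Set.Ico (0 : ℝ) 1)
    (hA_top : ∀ ω, A ∞ ω = 1)
    (ν : Ω → Measure ℝ≥0∞) (hν_prob : ∀ ω, IsProbabilityMeasure (ν ω))
    (hν : ∀ ω, ∀ u : ℝ≥0∞, ν ω (Set.Iic u) = ENNReal.ofReal (A u ω))
    -- the Cox measure `Q̌⁰` associated with `(Q, F, A, τ̂)`
    (Q0 : Measure (Ω × ℝ≥0∞))
    (hQ0 : ∀ h : Ω × ℝ≥0∞ → ℝ≥0∞, Measurable h →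
      ∫⁻ p, h p ∂Q0 = ∫⁻ ω, ∫⁻ v, h (ω, v) ∂(ν ω) ∂Q)
    (T : ℝ≥0∞) (hT : 0 < T)
    (hdiff : ∀ t : ℝ≥0∞, t < T →
      ∃ pt : Ω × ℝ≥0∞ → ℝ, (∀ p, 0 ≤ pt p) ∧
        (@Measurable (Ω × ℝ≥0∞) ℝ
          ((F t).prod (inferInstance : MeasurableSpace ℝ≥0∞)) _ pt) ∧
        (∀ u : ℝ≥0∞, u ≤ t →
          (fun ω => (∫⁻ v in Set.Iic u, ENNReal.ofReal (pt (ω, v)) ∂(ν ω)).toReal)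
            =ᵐ[Q] Q[(fun ω => if τ ω ≤ u then (1 : ℝ) else 0) | F t])) :
    ∀ t : ℝ≥0∞, t < T →
      ∀ s : Set (Ω × ℝ≥0∞),
        MeasurableSet[⨅ (r : ℝ≥0∞) (_ : t < r),
          ((F r).comap Prod.fst ⊔
            MeasurableSpace.comap (fun p : Ω × ℝ≥0∞ => nmid p.2 r)
              (inferInstance : MeasurableSpace ℝ≥0∞))] s →
        Q0 s = 0 → Measure.map (fun ω => (ω, τ ω)) Q s = 0 := by
  intro t ht s hs hs0
  obtain ⟨r, htr, hrT⟩ := exists_between ht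
  have hr_top : r ≠ ∞ := (hrT.trans_le le_top).ne
  obtain ⟨p, -, hp_meas, hp⟩ := hdiff r hrT
  have hs_r : MeasurableSet[(F r).comap Prod.fst ⊔
      MeasurableSpace.comap (fun p : Ω × ℝ≥0∞ => nmid p.2 r)
        (inferInstance : MeasurableSpace ℝ≥0∞)] s :=
    (iInf₂_le (f := fun (r : ℝ≥0∞) (_ : t < r) => (F r).comap Prod.fst ⊔
      MeasurableSpace.comap (fun p : Ω × ℝ≥0∞ => nmid p.2 r)
        (inferInstance : MeasurableSpace ℝ≥0∞)) r htr) s hs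
  obtain ⟨S, hS, hsS⟩ := @exists_preimage_of_measurableSet_sup_comap_nmid Ω (F r) r s hs_r
  have hprod_le : (F r).prod (inferInstance : MeasurableSpace ℝ≥0∞) ≤
      (Prod.instMeasurableSpace : MeasurableSpace (Ω × ℝ≥0∞)) :=
    sup_le_sup (MeasurableSpace.comap_mono (hF_le r)) le_rfl
  have hs_prod : MeasurableSet[(F r).prod (inferInstance : MeasurableSpace ℝ≥0∞)] s := by
    rw [hsS]
    exact @measurable_prodMk_nmid Ω (F r) r S hS
  have hs_meas : MeasurableSet s := hprod_le s hs_prod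
  have hφ : Measurable fun ω => (ω, τ ω) := measurable_id.prodMk hτ
  have hQ0_apply : ∀ C : Set (Ω × ℝ≥0∞), MeasurableSet C →
      Q0 C = ∫⁻ ω, ν ω (Prod.mk ω ⁻¹' C) ∂Q := by
    intro C hC
    rw [← lintegral_indicator_one hC, hQ0 _ (measurable_one.indicator hC)]
    refine lintegral_congr fun ω => ?_
    rw [← lintegral_indicator_one (measurable_prodMk_left hC)]
    rfl
  -- After `r` the set `s` is a rectangle, and the Cox measure charges `(r, ∞]` fully.
  have h_after : Q {ω | (ω, τ ω) ∈ s ∧ r < τ ω} = 0 := by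
    set B : Set Ω := {ω | (ω, ∞) ∈ S} with hB_def
    have hB : MeasurableSet B :=
      hF_le r _ (@measurable_prodMk_right _ _ (F r) _ ∞ _ hS)
    have h_mem : ∀ ω v, r < v → ((ω, v) ∈ s ↔ ω ∈ B) := by
      intro ω v hv
      simp [hsS, hB_def, nmid, hv.not_ge]
    have h0 : ∫⁻ ω, B.indicator (fun ω => ν ω (Set.Ioi r)) ω ∂Q = 0 := by
      refine le_antisymm ?_ zero_le
      rw [← hs0, hQ0_apply s hs_meas]
      refine lintegral_mono fun ω => ?_
      by_cases hω : ω ∈ B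
      · rw [Set.indicator_of_mem hω]
        exact measure_mono fun v hv => (h_mem ω v hv).2 hω
      · simp [hω]
    have hIoi : ∀ ω, ν ω (Set.Ioi r) = 1 - ENNReal.ofReal (A r ω) := by
      intro ω
      rw [← Set.compl_Iic, prob_compl_eq_one_sub measurableSet_Iic, hν]
    simp_rw [hIoi] at h0
    rw [lintegral_eq_zero_iff] at h0
    · refine measure_mono_null (fun ω hω => ?_) h0
      have hωB : ω ∈ B := (h_mem ω _ hω.2).1 hω.1
      have h_lt : ENNReal.ofReal (A r ω) < 1 := ENNReal.ofReal_lt_one.2 (hA_mem r ω hr_top).2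
      simp [hωB, (tsub_pos_of_lt h_lt).ne']
    · exact ((((hA_adapted r).mono (hF_le r) le_rfl).ennreal_ofReal).const_sub _).indicator hB
  let g : ℝ≥0∞ → Ω → ℝ≥0∞ := fun u ω => ∫⁻ v in Set.Iic u, ENNReal.ofReal (p (ω, v)) ∂(ν ω)
  have hg_mono : ∀ ω, Monotone fun u => g u ω := fun ω u v huv =>
    lintegral_mono_set (Set.Iic_subset_Iic.2 huv)
  have hg_meas : Measurable[F r] (g r) := by
    refine @measurable_setLIntegral_Iic Ω (F r) ν _ r (fun u hu => ?_)
      (fun q => ENNReal.ofReal (p q)) hp_meas.ennreal_ofReal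
    simp_rw [hν]
    exact ((hA_adapted u).mono (hF_mono hu) le_rfl).ennreal_ofReal
  let N : Set Ω := {ω | g r ω = ∞}
  have hN : MeasurableSet[F r] N := hg_meas (measurableSet_singleton ∞)
  have hp' : ∀ u ≤ r, (fun ω => (g u ω).toReal) =ᵐ[Q]
      Q[(τ ⁻¹' Set.Iic u).indicator (fun _ => (1 : ℝ)) | F r] := by
    intro u hu
    have h : (τ ⁻¹' Set.Iic u).indicator (fun _ => (1 : ℝ)) =
        fun ω => if τ ω ≤ u then (1 : ℝ) else 0 := by
      funext ω
      by_cases hω : τ ω ≤ u <;> simp [hω]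
    rw [h]
    exact hp u hu
  -- The density may have infinite mass only where the conditional probability vanishes.
  have hg_ae : ∀ u ≤ r, ∀ᵐ ω ∂Q,
      Nᶜ.indicator (g u) ω = ENNReal.ofReal (g u ω).toReal := by
    intro u hu
    have h_le : Q[(τ ⁻¹' Set.Iic u).indicator (fun _ => (1 : ℝ)) | F r] ≤ᵐ[Q]
        Q[(τ ⁻¹' Set.Iic r).indicator (fun _ => (1 : ℝ)) | F r] :=
      condExp_mono ((integrable_const _).indicator (hτ measurableSet_Iic))
        ((integrable_const _).indicator (hτ measurableSet_Iic))
        (Filter.Eventually.of_forall fun ω => Set.indicator_le_indicator_of_subset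
          (Set.preimage_mono (Set.Iic_subset_Iic.2 hu)) (fun _ => zero_le_one) ω)
    filter_upwards [hp' u hu, hp' r le_rfl, h_le] with ω h1 h2 h3
    by_cases hω : ω ∈ N
    · rw [← h1, ← h2, show g r ω = ∞ from hω, ENNReal.toReal_top] at h3
      simp [hω, h3]
    · have : g u ω ≠ ∞ := ((hg_mono ω hu).trans_lt (lt_top_iff_ne_top.2 hω)).ne
      simp [hω, ENNReal.ofReal_toReal this]
  let f : Ω × ℝ≥0∞ → ℝ≥0∞ :=
    (Nᶜ ×ˢ Set.Iic r).indicator fun q => ENNReal.ofReal (p q)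
  have hf : Measurable f :=
    (hp_meas.mono hprod_le le_rfl).ennreal_ofReal.indicator
      ((hF_le r _ hN).compl.prod measurableSet_Iic)
  have h_rect : ∀ B, MeasurableSet[F r] B → ∀ u,
      (Measure.map (fun ω => (ω, τ ω)) Q).restrict (Prod.snd ⁻¹' Set.Iic r) (B ×ˢ Set.Iic u) =
        Q0.withDensity f (B ×ˢ Set.Iic u) := by
    intro B hB u
    have hB' := hF_le r _ hB
    have hC : MeasurableSet (B ×ˢ Set.Iic u) := hB'.prod measurableSet_Iic
    have hur : u ⊓ r ≤ r := inf_le_right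
    rw [Measure.restrict_apply hC,
      Measure.map_apply hφ (hC.inter (measurable_snd measurableSet_Iic)),
      withDensity_apply _ hC, ← lintegral_indicator hC, hQ0 _ (hf.indicator hC)]
    trans Q (B ∩ τ ⁻¹' Set.Iic (u ⊓ r))
    · congr 1
      ext ω
      simp [and_assoc]
    rw [← setLIntegral_ofReal_toReal_eq_measure_inter (hF_le r) (hτ measurableSet_Iic) hB
        (hp' _ hur), ← lintegral_indicator hB']
    refine lintegral_congr_ae ?_
    filter_upwards [hg_ae _ hur] with ω hω
    by_cases hωB : ω ∈ B
    · rw [Set.indicator_of_mem hωB, ← hω]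
      by_cases hωN : ω ∈ N
      · simp [hωN, f, Set.indicator]
      · rw [Set.indicator_of_mem (show ω ∈ Nᶜ from hωN)]
        simp only [g]
        rw [← lintegral_indicator measurableSet_Iic]
        refine lintegral_congr fun v => ?_
        by_cases hvu : v ≤ u <;> by_cases hvr : v ≤ r <;>
          simp [f, hωB, hωN, hvu, hvr]
    · simp [hωB]
  have h_before : (Measure.map (fun ω => (ω, τ ω)) Q).restrict (Prod.snd ⁻¹' Set.Iic r) s = 0 := by
    have : IsFiniteMeasure (Measure.map (fun ω => (ω, τ ω)) Q) :=
      Measure.isFiniteMeasure_map Q _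
    rw [ext_on_measurableSpace_of_generate_finite _ _ ?_ hprod_le
      (@generateFrom_image2_prod_range_Iic Ω (F r)).symm
      (@isPiSystem_image2_prod_range_Iic Ω (F r)) ?_ hs_prod]
    · exact withDensity_absolutelyContinuous Q0 f hs0
    · rintro _ ⟨B, hB, _, ⟨u, rfl⟩, rfl⟩
      exact h_rect B hB u
    · have := h_rect Set.univ (@MeasurableSet.univ _ (F r)) ∞
      rwa [Set.Iic_top, Set.univ_prod_univ] at this
  rw [Measure.restrict_apply hs_meas,
    Measure.map_apply hφ (hs_meas.inter (measurable_snd measurableSet_Iic))] at h_before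
  rw [Measure.map_apply hφ hs_meas]
  refine measure_mono_null (fun ω hω => ?_) (measure_union_null h_before h_after)
  rcases le_or_gt (τ ω) r with h | h
  · exact Or.inl ⟨hω, h⟩
  · exact Or.inr ⟨hω, h⟩
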